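/- arXiv:2208.10162 — 2 statements merged into one kernel-verified Lean document; each statement's English description precedes it below -/
import Mathlib

section
/- Let α > 0, h > 0, 0 < ε < 1, U > 0 and β be reals satisfying: (C1) 0 < αh < 2/3; (C2) 0 < β < A(αh,ε) < 1; (C4) 1 − 2αh(1 − ε) + (αh)²ε(1 + ε) ≥ 0; and (C3) δ(h,αh,β) < ε, where δ(h,αh,β) = h·√(N(h,αh,ε,U)/(A(αh,ε) − β)). Suppose the quaternion sequence (q_k) satisfies q_{k+1} = (1 − αh(‖q_k‖² − 1)) q_k + (h/2) q_k w_k with each w_k pure imaginary, and let e_k = ‖q_k‖² − 1. If at step k one has ‖w_k‖ ≤ U and δ(h,αh,β) < |e_k| ≤ ε, then e_{k+1}² ≤ (1 − β)·e_k². -/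
/-- Multiplying by a pure imaginary quaternion on the right is orthogonal to the identity. -/
theorem Quaternion.norm_sq_smul_add_smul_mul (q w : Quaternion ℝ) (hw : w.re = 0) (s t : ℝ) :
    ‖s • q + t • (q * w)‖ ^ 2 = ‖q‖ ^ 2 * (s ^ 2 + t ^ 2 * ‖w‖ ^ 2) := by
  simp only [sq ‖_‖, ← Quaternion.normSq_eq_norm_mul_self, Quaternion.normSq_def', Quaternion.re_add,
    Quaternion.imI_add, Quaternion.imJ_add, Quaternion.imK_add, Quaternion.re_smul,
    Quaternion.imI_smul, Quaternion.imJ_smul, Quaternion.imK_smul, Quaternion.re_mul,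
    Quaternion.imI_mul, Quaternion.imJ_mul, Quaternion.imK_mul, hw, smul_eq_mul]
  ring

/-- The square of the drift multiplier of the error on the `ε`-ball. -/
theorem drift_multiplier_sq_le {a ε e : ℝ} (ha0 : 0 < a) (ha : a < 2 / 3) (hε1 : ε < 1)
    (hlo : -ε ≤ e) (hhi : e ≤ ε) :
    (1 - 2 * a * (1 + e) + a ^ 2 * e * (1 + e)) ^ 2 ≤
      1 - a * (1 - ε) * (2 - a * ε) * (2 - 2 * a - a * (2 - a) * ε + a ^ 2 * ε ^ 2) := by
  have hε0 : 0 ≤ ε := by linarith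
  have hR : 0 ≤ 2 - 2 * a - a * (2 - a) * ε + a ^ 2 * ε ^ 2 := by
    have : 0 ≤ (1 - ε) * (a * (2 - a - a * (1 + ε))) :=
      mul_nonneg (by linarith) (mul_nonneg ha0.le (by nlinarith))
    nlinarith [sq_nonneg (1 - a)]
  have hRe : 2 - 2 * a - a * (2 - a) * ε + a ^ 2 * ε ^ 2 ≤
      2 - 2 * a - a * (2 - a) * e + a ^ 2 * e ^ 2 := by
    have : 0 ≤ (ε - e) * (a * (2 - a - a * (ε + e))) :=
      mul_nonneg (by linarith) (mul_nonneg ha0.le (by nlinarith))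
    nlinarith
  have hP : a * (1 - ε) * (2 - a * ε) ≤ a * (1 + e) * (2 - a * e) := by
    apply mul_le_mul
    · exact mul_le_mul_of_nonneg_left (by linarith) ha0.le
    · nlinarith
    · nlinarith
    · exact mul_nonneg ha0.le (by linarith)
  have hP0 : 0 ≤ a * (1 + e) * (2 - a * e) :=
    mul_nonneg (mul_nonneg ha0.le (by linarith)) (by nlinarith)
  have := mul_le_mul hP hRe hR hP0
  linarith

/-- When the drift multiplier can be negative, the contraction margin absorbs its square. -/
theorem overshoot_sq_le {a ε : ℝ} (ha0 : 1 / 2 ≤ a) (ha : a < 2 / 3) (hε0 : 0 < ε) (hε1 : ε < 1)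
    (hG : 0 ≤ 1 - 2 * a * (1 - ε) + a ^ 2 * ε * (1 + ε)) :
    (2 * a - 1) ^ 2 * (1 + ε) ^ 2 ≤
      (1 - a * (1 - ε) * (2 - a * ε) * (2 - 2 * a - a * (2 - a) * ε + a ^ 2 * ε ^ 2)) *
        (ε * (2 + ε)) := by
  have hR : 0 ≤ 2 - 2 * a - a * (2 - a) * ε + a ^ 2 * ε ^ 2 := by
    have : 0 ≤ (1 - ε) * (a * (2 - a - a * (1 + ε))) :=
      mul_nonneg (by linarith) (mul_nonneg (by linarith) (by nlinarith))
    nlinarith [sq_nonneg (1 - a)]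
  have hA : a * (1 - ε) * (2 - a * ε) * (2 - 2 * a - a * (2 - a) * ε + a ^ 2 * ε ^ 2) ≤
      a * (1 - ε) * 2 * (2 - 2 * a - a * (2 - a) * ε + a ^ 2 * ε ^ 2) := by
    refine mul_le_mul_of_nonneg_right (mul_le_mul_of_nonneg_left ?_ ?_) hR
    · nlinarith
    · exact mul_nonneg (by linarith) (by linarith)
  have key : (2 * a - 1) ^ 2 ≤
      ε ^ 2 * ((2 + ε) * (a * (4 - 2 * a ^ 2 - 4 * a * ε + 2 * a ^ 2 * ε ^ 2))) := by
    rcases le_total ε (7 / 25) with h | h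
    · have hx : 2 * a - 1 ≤ ε * (a * (2 + a + a * ε)) := by linarith
      have hx2 := pow_le_pow_left₀ (by linarith) hx 2
      have hp : a * (2 + a + a * ε) ^ 2 ≤
          (2 + ε) * (4 - 2 * a ^ 2 - 4 * a * ε + 2 * a ^ 2 * ε ^ 2) := by
        have h1 : a * (2 + a + a * ε) ^ 2 ≤ 2 / 3 * (2 + 2 / 3 + 2 / 3 * ε) ^ 2 := by
          gcongr
        have h2 : 4 - 2 * (2 / 3) ^ 2 - 4 * (2 / 3) * ε + 2 * (2 / 3) ^ 2 * ε ^ 2 ≤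
            4 - 2 * a ^ 2 - 4 * a * ε + 2 * a ^ 2 * ε ^ 2 := by
          have : 0 ≤ (2 / 3 - a) * (2 * (2 / 3 + a) * (1 - ε ^ 2) + 4 * ε) :=
            mul_nonneg (by linarith)
              (add_nonneg (mul_nonneg (by linarith) (by nlinarith)) (by linarith))
          linarith
        have h3 := mul_le_mul_of_nonneg_left h2 (by linarith : 0 ≤ 2 + ε)
        nlinarith [pow_pos hε0 3]
      calc (2 * a - 1) ^ 2 ≤ (ε * (a * (2 + a + a * ε))) ^ 2 := hx2
        _ = ε ^ 2 * (a * (a * (2 + a + a * ε) ^ 2)) := by ring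
        _ ≤ ε ^ 2 * (a * ((2 + ε) * (4 - 2 * a ^ 2 - 4 * a * ε + 2 * a ^ 2 * ε ^ 2))) := by
          gcongr
        _ = _ := by ring
    · have h1 : (2 * a - 1) ^ 2 ≤ 1 / 9 := by nlinarith
      have h2 : 4 / 3 ≤ 4 - 2 * a ^ 2 - 4 * a * ε + 2 * a ^ 2 * ε ^ 2 := by
        have : 0 ≤ (1 - ε) * (a * (4 - 2 * a * (1 + ε))) :=
          mul_nonneg (by linarith) (mul_nonneg (by linarith) (by nlinarith))
        nlinarith
      calc (2 * a - 1) ^ 2 ≤ 1 / 9 := h1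
        _ ≤ (7 / 25) ^ 2 * ((2 + 7 / 25) * (1 / 2 * (4 / 3))) := by norm_num
        _ ≤ _ := by gcongr
  have := mul_le_mul_of_nonneg_right hA (by positivity : 0 ≤ ε * (2 + ε))
  linarith

/-- A weighted form of `(x + y)² ≤ …`, with weights `(1 + ε)⁻² + ε (2 + ε) (1 + ε)⁻² = 1`. -/
theorem add_sq_le_of_weighted {ε A γ t D : ℝ} (hε : 0 < ε)
    (hγ : γ ^ 2 * (1 + ε) ^ 2 ≤ (1 - A) * (ε * (2 + ε))) :
    (γ * t + D) ^ 2 ≤ (1 - A) * t ^ 2 + ((1 + ε) * D) ^ 2 := by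
  have hm : 0 < ε * (2 + ε) := by positivity
  have h := mul_le_mul_of_nonneg_right hγ (sq_nonneg t)
  refine le_of_mul_le_mul_left ?_ hm
  linarith [sq_nonneg (γ * t - ε * (2 + ε) * D)]


/-- Outside the δ-ball (but inside the ε-ball), the Lyapunov function of the
error dynamics contracts by a factor `1 - β`. -/
theorem lyapunov_contraction (α h ε U β A N δ : ℝ)
    (hα : 0 < α) (hh : 0 < h) (hε0 : 0 < ε) (hε1 : ε < 1) (hU : 0 < U)
    (hA : A = α * h * (1 - ε) * (2 - α * h * ε) *
      (2 - 2 * (α * h) - α * h * (2 - α * h) * ε + (α * h) ^ 2 * ε ^ 2))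
    (hN : N = (1 - 2 * (α * h) * (1 - ε) + (α * h) ^ 2 * ε * (1 + ε)) *
        (ε * (1 + ε)) * U ^ 2 / 2 + (1 + ε) ^ 2 * (h ^ 2 * U ^ 4 / 16))
    (hδ : δ = h * Real.sqrt (N / (A - β)))
    (hC1 : 0 < α * h ∧ α * h < 2 / 3)
    (hC2 : 0 < β ∧ β < A ∧ A < 1)
    (hC4 : 1 - 2 * (α * h) * (1 - ε) + (α * h) ^ 2 * ε * (1 + ε) ≥ 0)
    (hC3 : δ < ε)
    (q w : ℕ → Quaternion ℝ) (hw : ∀ k, (w k).re = 0)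
    (hdyn : ∀ k, q (k + 1) =
      (1 - α * h * (‖q k‖ ^ 2 - 1)) • q k + (h / 2) • (q k * w k))
    (e : ℕ → ℝ) (he : ∀ k, e k = ‖q k‖ ^ 2 - 1)
    (k : ℕ) (hwk : ‖w k‖ ≤ U) (hlo : δ < |e k|) (hhi : |e k| ≤ ε) :
    e (k + 1) ^ 2 ≤ (1 - β) * e k ^ 2 := by
  obtain ⟨ha0, ha⟩ := hC1
  obtain ⟨-, hβA, -⟩ := hC2
  have hnext : e (k + 1) = e k *
      (1 - 2 * (α * h) * (1 + e k) + (α * h) ^ 2 * e k * (1 + e k)) +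
      h ^ 2 / 4 * ((1 + e k) * ‖w k‖ ^ 2) := by
    rw [he (k + 1), hdyn, Quaternion.norm_sq_smul_add_smul_mul _ _ (hw k), he k]
    ring
  obtain ⟨hlo', hhi'⟩ := abs_le.mp hhi
  have hW : ‖w k‖ ^ 2 ≤ U ^ 2 := pow_le_pow_left₀ (norm_nonneg _) hwk 2
  have hW0 : 0 ≤ ‖w k‖ ^ 2 := sq_nonneg _
  have hN0 : 0 ≤ N := by
    rw [hN]
    have := mul_nonneg hC4 (by positivity : 0 ≤ ε * (1 + ε) * U ^ 2 / 2)
    have : 0 ≤ (1 + ε) ^ 2 * (h ^ 2 * U ^ 4 / 16) := by positivity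
    linarith
  have hδe : h ^ 2 * N ≤ (A - β) * e k ^ 2 := by
    have hd : 0 < A - β := sub_pos.mpr hβA
    have h1 : δ ^ 2 ≤ e k ^ 2 := by
      rw [← sq_abs (e k)]
      exact pow_le_pow_left₀ (by rw [hδ]; positivity) hlo.le 2
    rw [hδ, mul_pow, Real.sq_sqrt (div_nonneg hN0 hd.le), mul_div_assoc', div_le_iff₀ hd] at h1
    linarith
  have hdrift := drift_multiplier_sq_le ha0 ha hε1 hlo' hhi'
  rw [← hA] at hdrift
  rw [hnext]
  clear hnext hdyn hδ hlo hC3 hwk hw hhi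
  generalize e k = x at *
  generalize ‖w k‖ ^ 2 = W at *
  generalize α * h = a at *
  set g := 1 - 2 * a * (1 + x) + a ^ 2 * x * (1 + x) with hg
  set c := h ^ 2 / 4 * ((1 + x) * W) with hc
  have hc0 : 0 ≤ c := by
    have : 0 ≤ 1 + x := by linarith
    positivity
  have hgx := mul_le_mul_of_nonneg_right hdrift (sq_nonneg x)
  by_cases hneg : x < 0 ∧ g < 0
  · obtain ⟨hx, hg0⟩ := hneg
    have hcD : c ≤ h ^ 2 / 4 * U ^ 2 := by
      rw [hc]
      gcongr
      nlinarith
    have hγ : -g ≤ 2 * a - 1 := by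
      have : 0 ≤ -x * (a * (2 - a * (1 + x))) :=
        mul_nonneg (by linarith) (mul_nonneg ha0.le (by nlinarith))
      rw [hg]
      linarith
    have hover := overshoot_sq_le (by linarith) ha hε0 hε1 hC4
    rw [← hA] at hover
    have hweighted := add_sq_le_of_weighted (t := -x) (D := h ^ 2 / 4 * U ^ 2) hε0 hover
    have hmono : (x * g + c) ^ 2 ≤ ((2 * a - 1) * -x + h ^ 2 / 4 * U ^ 2) ^ 2 := by
      have : 0 ≤ x * g := mul_nonneg_of_nonpos_of_nonpos hx.le hg0.le
      have := mul_le_mul_of_nonneg_right hγ (neg_nonneg.mpr hx.le)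
      exact pow_le_pow_left₀ (by linarith) (by linarith) 2
    have hN2 : ((1 + ε) * (h ^ 2 / 4 * U ^ 2)) ^ 2 ≤ h ^ 2 * N := by
      rw [hN]
      have := mul_nonneg hC4 (by positivity : 0 ≤ h ^ 2 * (ε * (1 + ε) * U ^ 2 / 2))
      linarith
    linarith
  · have hcD : c ≤ h ^ 2 / 4 * ((1 + ε) * U ^ 2) := by
      rw [hc]
      gcongr
    have hcross : x * g ≤ ε * (1 - 2 * a * (1 - ε) + a ^ 2 * ε * (1 + ε)) := by
      rcases le_or_gt g 0 with hg0 | hg0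
      · rcases lt_or_ge x 0 with hx | hx
        · have : g = 0 := le_antisymm hg0 (not_lt.mp fun h' => hneg ⟨hx, h'⟩)
          rw [this, mul_zero]
          exact mul_nonneg hε0.le hC4
        · exact (mul_nonpos_of_nonneg_of_nonpos hx hg0).trans (mul_nonneg hε0.le hC4)
      · refine mul_le_mul hhi' ?_ hg0.le hε0.le
        have h1 : 0 ≤ a * (x + ε) := mul_nonneg ha0.le (by linarith)
        have h2 : 0 ≤ a ^ 2 * ((ε - x) * (1 + ε + x)) :=
          mul_nonneg (sq_nonneg a) (mul_nonneg (by linarith) (by linarith))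
        rw [hg]
        linarith
    have hcc : c * (x * g) ≤ h ^ 2 / 4 * ((1 + ε) * U ^ 2) *
        (ε * (1 - 2 * a * (1 - ε) + a ^ 2 * ε * (1 + ε))) :=
      (mul_le_mul_of_nonneg_left hcross hc0).trans
        (mul_le_mul_of_nonneg_right hcD (mul_nonneg hε0.le hC4))
    have hc2 := pow_le_pow_left₀ hc0 hcD 2
    rw [hN] at hδe
    linarith
end

section
/- Let α > 0, h > 0, 0 < ε < 1, U > 0 and β be reals satisfying conditions (C1) 0 < αh < 2/3, (C2) 0 < β < A(αh,ε) < 1, (C4) 1 − 2αh(1 − ε) + (αh)²ε(1 + ε) ≥ 0, and (C3) δ(h,αh,β) < ε. Suppose the quaternion sequence (q_k) satisfies q_{k+1} = (1 − αh(‖q_k‖² − 1)) q_k + (h/2) q_k w_k with each w_k pure imaginary, and let e_k = ‖q_k‖² − 1. If at step k one has ‖w_k‖ ≤ U and |e_k| ≤ δ(h,αh,0), then |e_{k+1}| ≤ δ(h,αh,0). -/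
lemma Quaternion.norm_sq_smul_add_smul_mul_of_re_eq_zero (q w : Quaternion ℝ) (r c : ℝ)
    (hw : w.re = 0) :
    ‖r • q + c • (q * w)‖ ^ 2 = ‖q‖ ^ 2 * (r ^ 2 + c ^ 2 * ‖w‖ ^ 2) := by
  simp only [← Quaternion.normSq_eq_norm_mul_self, pow_two ‖_‖, Quaternion.normSq_def']
  simp [hw]
  ring

/-- The growth factor `1 - 2a - a(2-a)x + a²x²` of the unforced error dynamics has square at most
`1 - A` on `[-ε, ε]`. -/
lemma sq_growthFactor_le {a ε x : ℝ} (ha : 0 < a) (ha' : a < 2 / 3) (hε1 : ε < 1)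
    (hx : |x| ≤ ε) :
    (1 - 2 * a - a * (2 - a) * x + a ^ 2 * x ^ 2) ^ 2 ≤
      1 - a * (1 - ε) * (2 - a * ε) * (2 - 2 * a - a * (2 - a) * ε + a ^ 2 * ε ^ 2) := by
  obtain ⟨hx1, hx2⟩ := abs_le.mp hx
  have hε : 0 ≤ ε := (abs_nonneg x).trans hx
  have hax : a * x ≤ a * ε := by gcongr
  have haε : a * ε ≤ a := by nlinarith
  have h1 : a * (1 - ε) * (2 - a * ε) ≤ a * (1 + x) * (2 - a * x) := by
    gcongr <;> nlinarith
  have h2 : 2 - 2 * a - a * (2 - a) * ε + a ^ 2 * ε ^ 2 ≤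
      2 - 2 * a - a * (2 - a) * x + a ^ 2 * x ^ 2 := by
    nlinarith [mul_nonneg (mul_nonneg ha.le (sub_nonneg.2 hx2))
      (show 0 ≤ 2 - a - a * ε - a * x by nlinarith)]
  have h3 : 0 ≤ 2 - 2 * a - a * (2 - a) * ε + a ^ 2 * ε ^ 2 := by
    nlinarith [mul_nonneg (mul_nonneg ha.le (sub_nonneg.2 hε1.le))
      (show 0 ≤ 2 - a - a * ε - a by nlinarith)]
  have h4 : 0 ≤ a * (1 + x) * (2 - a * x) :=
    mul_nonneg (mul_nonneg ha.le (by linarith)) (by linarith)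
  nlinarith [mul_le_mul h1 h2 h3 h4]

lemma contractionRate_le_sq {a ε : ℝ} (ha : 1 / 2 ≤ a) (ha' : a < 2 / 3) (hε : 0 < ε)
    (hε1 : ε < 1) (hC : 0 ≤ 1 - 2 * a * (1 - ε) + a ^ 2 * ε * (1 + ε)) :
    a * (1 - ε) * (2 - a * ε) * (2 - 2 * a - a * (2 - a) * ε + a ^ 2 * ε ^ 2) ≤
      ((2 - 2 * a) * (1 + ε)) ^ 2 := by
  have h1 : 2 - 2 * a - a * (2 - a) * ε + a ^ 2 * ε ^ 2 ≤ (2 - 2 * a) * (1 - a * ε) := by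
    nlinarith [mul_nonneg (mul_nonneg (sq_nonneg a) hε.le) (sub_nonneg.2 hε1.le)]
  have h2 : a * (1 - ε) * (2 - a * ε) * (1 - a * ε) ≤ (2 - 2 * a) * (1 + ε) ^ 2 := by
    rcases le_total ε (1 / 5) with hε5 | hε5
    · have h3 : (2 - 2 * a) * (1 + ε) ^ 2 - a * (1 - ε) * (2 - a * ε) * (1 - a * ε) =
          2 * (1 - 2 * a * (1 - ε) + a ^ 2 * ε * (1 + ε)) +
          ε * (4 - 6 * a + a ^ 2 + ε * (2 - 2 * a - 5 * a ^ 2 - a ^ 3) + a ^ 3 * ε ^ 2) := by ring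
      have h4 : a ^ 2 ≤ (2 / 3) * a := by nlinarith
      have h4' : a ^ 3 ≤ (4 / 9) * a := by nlinarith
      have h5 : 2 - 2 * a - 5 * a ^ 2 - a ^ 3 ≥ -17 / 9 := by nlinarith
      have h6 : 4 - 6 * a + a ^ 2 ≥ 4 / 9 := by nlinarith
      have h7 : 0 ≤ a ^ 3 * ε ^ 2 := by positivity
      have h8 : 0 ≤ 4 - 6 * a + a ^ 2 + ε * (2 - 2 * a - 5 * a ^ 2 - a ^ 3) + a ^ 3 * ε ^ 2 := by
        nlinarith
      linarith [mul_nonneg hε.le h8]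
    · have h3 : a * (1 - ε) * (2 - a * ε) * (1 - a * ε) ≤ 2 / 3 * (4 / 5) * (19 / 10) * (9 / 10) := by
        have : 1 / 10 ≤ a * ε := by nlinarith
        have : a * ε ≤ 1 := by nlinarith
        gcongr <;> nlinarith
      have h4 : (2 / 3) * (6 / 5) ^ 2 ≤ (2 - 2 * a) * (1 + ε) ^ 2 := by
        gcongr <;> linarith
      linarith
  have h3 : 0 ≤ a * (1 - ε) * (2 - a * ε) :=
    mul_nonneg (mul_nonneg (by linarith) (by linarith)) (by nlinarith)
  nlinarith [mul_le_mul_of_nonneg_left h1 h3,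
    mul_le_mul_of_nonneg_left h2 (show 0 ≤ 2 - 2 * a by linarith)]

/-- The δ(·,·,0)-ball is positively invariant for the error dynamics. -/
theorem error_invariant_ball (α h ε U β A N δβ δ0 : ℝ)
    (hα : 0 < α) (hh : 0 < h) (hε0 : 0 < ε) (hε1 : ε < 1) (hU : 0 < U)
    (hA : A = α * h * (1 - ε) * (2 - α * h * ε) *
      (2 - 2 * (α * h) - α * h * (2 - α * h) * ε + (α * h) ^ 2 * ε ^ 2))
    (hN : N = (1 - 2 * (α * h) * (1 - ε) + (α * h) ^ 2 * ε * (1 + ε)) *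
        (ε * (1 + ε)) * U ^ 2 / 2 + (1 + ε) ^ 2 * (h ^ 2 * U ^ 4 / 16))
    (hδβ : δβ = h * Real.sqrt (N / (A - β)))
    (hδ0 : δ0 = h * Real.sqrt (N / A))
    (hC1 : 0 < α * h ∧ α * h < 2 / 3)
    (hC2 : 0 < β ∧ β < A ∧ A < 1)
    (hC4 : 1 - 2 * (α * h) * (1 - ε) + (α * h) ^ 2 * ε * (1 + ε) ≥ 0)
    (hC3 : δβ < ε)
    (q w : ℕ → Quaternion ℝ) (hw : ∀ k, (w k).re = 0)
    (hdyn : ∀ k, q (k + 1) =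
      (1 - α * h * (‖q k‖ ^ 2 - 1)) • q k + (h / 2) • (q k * w k))
    (e : ℕ → ℝ) (he : ∀ k, e k = ‖q k‖ ^ 2 - 1)
    (k : ℕ) (hwk : ‖w k‖ ≤ U) (hek : |e k| ≤ δ0) :
    |e (k + 1)| ≤ δ0 := by
  obtain ⟨ha, ha'⟩ := hC1
  obtain ⟨hβ, hβA, -⟩ := hC2
  have hApos : 0 < A := hβ.trans hβA
  have hNlower : (1 + ε) ^ 2 * (h ^ 2 * U ^ 4 / 16) ≤ N := by
    rw [hN]
    have : 0 ≤ (1 - 2 * (α * h) * (1 - ε) + (α * h) ^ 2 * ε * (1 + ε)) *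
        (ε * (1 + ε)) * U ^ 2 / 2 := by
      have := mul_nonneg hC4 (show 0 ≤ ε * (1 + ε) by positivity)
      positivity
    linarith
  have hN0 : 0 ≤ N := le_trans (by positivity) hNlower
  have hδ0nonneg : 0 ≤ δ0 := by rw [hδ0]; positivity
  have hδ0ε : δ0 < ε := by
    refine lt_of_le_of_lt ?_ hC3
    rw [hδ0, hδβ]
    have : 0 < A - β := sub_pos.2 hβA
    gcongr
    linarith
  have hδ0sq : δ0 ^ 2 * A = h ^ 2 * N := by
    rw [hδ0, mul_pow, Real.sq_sqrt (by positivity)]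
    field_simp
  have hxε : |e k| ≤ ε := hek.trans hδ0ε.le
  have hnorm := Quaternion.norm_sq_smul_add_smul_mul_of_re_eq_zero (q k) (w k)
    (1 - α * h * (‖q k‖ ^ 2 - 1)) (h / 2) (hw k)
  rw [← hdyn k, ← he k, show ‖q k‖ ^ 2 = 1 + e k by rw [he]; ring] at hnorm
  have hW : ‖w k‖ ^ 2 ≤ U ^ 2 := by gcongr
  have hW0 : 0 ≤ ‖w k‖ ^ 2 := by positivity
  rw [he (k + 1), hnorm]
  generalize ‖w k‖ ^ 2 = W at hW hW0 ⊢
  have hrate := sq_growthFactor_le ha ha' hε1 hxε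
  rw [← hA] at hrate
  generalize e k = x at *
  obtain ⟨hx1, hx2⟩ := abs_le.mp hxε
  generalize α * h = a at *
  set g := 1 - 2 * a - a * (2 - a) * x + a ^ 2 * x ^ 2 with hg
  have hstep : (1 + x) * ((1 - a * x) ^ 2 + (h / 2) ^ 2 * W) - 1 =
      x * g + (1 + x) * (h ^ 2 * W / 4) := by rw [hg]; ring
  rw [hstep]
  have hx0 : 0 ≤ 1 + x := by linarith
  have hforce : (1 + x) * (h ^ 2 * W / 4) ≤ (1 + ε) * (h ^ 2 * U ^ 2 / 4) := by gcongr
  have hforce0 : 0 ≤ (1 + x) * (h ^ 2 * W / 4) := by positivity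
  have hxsq : x ^ 2 ≤ δ0 ^ 2 := sq_le_sq' (abs_le.mp hek).1 (abs_le.mp hek).2
  have of_cross (hcross : x * g * ((1 + x) * (h ^ 2 * W / 4)) * 2 ≤
      h ^ 2 * (N - (1 + ε) ^ 2 * (h ^ 2 * U ^ 4 / 16))) :
      |x * g + (1 + x) * (h ^ 2 * W / 4)| ≤ δ0 := by
    refine abs_le_of_sq_le_sq ?_ hδ0nonneg
    have h1 := pow_le_pow_left₀ hforce0 hforce 2
    have h2 : x ^ 2 * g ^ 2 ≤ δ0 ^ 2 * (1 - A) :=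
      mul_le_mul hxsq hrate (sq_nonneg g) (sq_nonneg δ0)
    linarith
  have hrem : 0 ≤ h ^ 2 * (N - (1 + ε) ^ 2 * (h ^ 2 * U ^ 4 / 16)) :=
    mul_nonneg (sq_nonneg h) (sub_nonneg.2 hNlower)
  rcases le_total 0 x with hx | hx
  · rcases le_total g 0 with hg0 | hg0
    · refine of_cross (le_trans ?_ hrem)
      have := mul_nonneg (mul_nonneg hx (neg_nonneg.2 hg0)) hforce0
      linarith
    · apply of_cross
      have hgC : g ≤ 1 - 2 * a * (1 - ε) + a ^ 2 * ε * (1 + ε) := by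
        have h1 : 0 ≤ a * x := by positivity
        have h2 : a ^ 2 * x ^ 2 ≤ a ^ 2 * ε ^ 2 := by gcongr
        have h3 : 0 ≤ a * ε := by positivity
        have h4 : 0 ≤ a ^ 2 * ε := by positivity
        linarith [mul_nonneg h1 (show 0 ≤ 2 - a by linarith)]
      have hxg : x * g ≤ ε * (1 - 2 * a * (1 - ε) + a ^ 2 * ε * (1 + ε)) := by gcongr
      have := mul_le_mul hxg hforce hforce0 (mul_nonneg hε0.le hC4)
      rw [hN]
      linarith
  · rcases le_total 0 g with hg0 | hg0
    · refine of_cross (le_trans ?_ hrem)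
      have := mul_nonneg (mul_nonneg (neg_nonneg.2 hx) hg0) hforce0
      linarith
    · have hgl : 1 - 2 * a ≤ g := by
        linarith [mul_nonneg (mul_nonneg ha.le (neg_nonneg.2 hx)) (show 0 ≤ 2 - a by linarith),
          mul_nonneg (sq_nonneg a) (sq_nonneg x)]
      have hAle := contractionRate_le_sq (show 1 / 2 ≤ a by linarith) ha' hε0 hε1 hC4
      rw [← hA] at hAle
      have hforce' : h ^ 2 * U ^ 2 / 4 ≤ (2 - 2 * a) * δ0 := by
        have h2a : 0 ≤ 2 - 2 * a := by linarith
        have : (1 + ε) * (h ^ 2 * U ^ 2 / 4) ≤ (1 + ε) * ((2 - 2 * a) * δ0) := by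
          refine (abs_le_of_sq_le_sq' ?_ (by positivity)).2
          linarith [mul_le_mul_of_nonneg_left hAle (sq_nonneg δ0),
            mul_le_mul_of_nonneg_left hNlower (sq_nonneg h)]
        exact le_of_mul_le_mul_left this (by linarith)
      have h1 : x * g ≤ δ0 * (2 * a - 1) := by
        have := mul_le_mul (show -x ≤ δ0 by linarith [(abs_le.mp hek).1])
          (show -g ≤ 2 * a - 1 by linarith) (neg_nonneg.2 hg0) hδ0nonneg
        linarith
      have h2 : (1 + x) * (h ^ 2 * W / 4) ≤ 1 * (h ^ 2 * U ^ 2 / 4) := by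
        gcongr
        linarith
      rw [abs_of_nonneg (add_nonneg (mul_nonneg_of_nonpos_of_nonpos hx hg0) hforce0)]
      linarith
end
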